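/- arXiv:1401.8214 — 2 statements merged into one kernel-verified Lean document; each statement's English description precedes it below -/
import Mathlib

section
/- Let n ∈ ℝ³ with ‖n‖ = 1 and V ∈ ℝ, and set n_S = (1 + V²)^{−1/2} (n, −V) ∈ ℝ⁴ (so ‖n_S‖ = 1). For g = (a, s) ∈ ℝ³ × ℝ = ℝ⁴ define G = g − ⟨g, n_S⟩ n_S ∈ ℝ⁴, and write G = (G′, G₄) with G′ ∈ ℝ³ and G₄ ∈ ℝ. Then a − ⟨a, n⟩ n = G′ − V G₄ n. -/
open scoped RealInnerProductSpace

/-- `ℝ⁴` realized as the `L²` product `ℝ³ × ℝ`, with `mk4 x r = (x, r)`. -/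
noncomputable def mk4 (x : EuclideanSpace ℝ (Fin 3)) (r : ℝ) :
    WithLp 2 (EuclideanSpace ℝ (Fin 3) × ℝ) :=
  (WithLp.equiv 2 (EuclideanSpace ℝ (Fin 3) × ℝ)).symm (x, r)

/-- Spatial part `G′ ∈ ℝ³` of a space-time vector `G ∈ ℝ⁴`. -/
noncomputable def comp1 (g : WithLp 2 (EuclideanSpace ℝ (Fin 3) × ℝ)) :
    EuclideanSpace ℝ (Fin 3) :=
  (WithLp.equiv 2 (EuclideanSpace ℝ (Fin 3) × ℝ) g).1

/-- Temporal part `G₄ ∈ ℝ` of a space-time vector `G ∈ ℝ⁴`. -/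
noncomputable def comp2 (g : WithLp 2 (EuclideanSpace ℝ (Fin 3) × ℝ)) : ℝ :=
  (WithLp.equiv 2 (EuclideanSpace ℝ (Fin 3) × ℝ) g).2

/-- Relation (tanggrad1): with `n_S = (1+V²)^{-1/2}(n, -V)` and
`G = g - ⟨g, n_S⟩ n_S` for `g = (a, s)`, one has `a - ⟨a,n⟩n = G′ - V G₄ n`. -/
theorem statement7 (n : EuclideanSpace ℝ (Fin 3)) (hn : ‖n‖ = 1) (V : ℝ)
    (nS : WithLp 2 (EuclideanSpace ℝ (Fin 3) × ℝ))
    (hnS : nS = (Real.sqrt (1 + V ^ 2))⁻¹ • mk4 n (-V))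
    (a : EuclideanSpace ℝ (Fin 3)) (s : ℝ)
    (G : WithLp 2 (EuclideanSpace ℝ (Fin 3) × ℝ))
    (hG : G = mk4 a s - ⟪mk4 a s, nS⟫ • nS) :
    a - ⟪a, n⟫ • n = comp1 G - (V * comp2 G) • n := by
  have hpos : (0 : ℝ) < 1 + V ^ 2 := by positivity
  set c := (Real.sqrt (1 + V ^ 2))⁻¹ with hc
  have hc2 : c ^ 2 * (1 + V ^ 2) = 1 := by
    rw [hc, inv_pow, Real.sq_sqrt hpos.le, inv_mul_cancel₀ hpos.ne']
  have hinner : ⟪mk4 a s, nS⟫ = c * (⟪a, n⟫ - s * V) := by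
    rw [hnS, real_inner_smul_right, WithLp.prod_inner_apply]
    simp only [mk4, WithLp.equiv_symm_apply, Real.inner_apply]
    ring
  have h1 : comp1 G = a - (c * (⟪a, n⟫ - s * V) * c) • n := by
    rw [hG, hinner, hnS, smul_smul]
    rfl
  have h2 : comp2 G = s - (c * (⟪a, n⟫ - s * V) * c) * (-V) := by
    rw [hG, hinner, hnS, smul_smul]
    rfl
  rw [h1, h2, sub_sub, ← add_smul]
  congr 2
  linear_combination (s * V - ⟪a, n⟫) * hc2
end

section
/- Let n ∈ ℝ³ with ‖n‖ = 1, w ∈ ℝ³, and set V = ⟨w, n⟩ and n_S = (1 + V²)^{−1/2} (n, −V) ∈ ℝ⁴. For g = (a, s) ∈ ℝ³ × ℝ = ℝ⁴ define G = g − ⟨g, n_S⟩ n_S ∈ ℝ⁴, and write G = (G′, G₄) with G′ ∈ ℝ³ and G₄ ∈ ℝ. Then s + ⟨w, a⟩ = (1 + V²) G₄ + ⟨w, a − ⟨a, n⟩ n⟩. -/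
open scoped RealInnerProductSpace

/-- Relation (tanggrad2): with `V = ⟨w, n⟩`, `n_S = (1+V²)^{-1/2}(n, -V)` and
`G = g - ⟨g, n_S⟩ n_S` for `g = (a, s)`, one has
`s + ⟨w, a⟩ = (1 + V²) G₄ + ⟨w, a - ⟨a,n⟩n⟩`. -/
theorem statement8 (n w : EuclideanSpace ℝ (Fin 3)) (hn : ‖n‖ = 1)
    (V : ℝ) (hV : V = ⟪w, n⟫)
    (nS : WithLp 2 (EuclideanSpace ℝ (Fin 3) × ℝ))
    (hnS : nS = (Real.sqrt (1 + V ^ 2))⁻¹ • mk4 n (-V))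
    (a : EuclideanSpace ℝ (Fin 3)) (s : ℝ)
    (G : WithLp 2 (EuclideanSpace ℝ (Fin 3) × ℝ))
    (hG : G = mk4 a s - ⟪mk4 a s, nS⟫ • nS) :
    s + ⟪w, a⟫ = (1 + V ^ 2) * comp2 G + ⟪w, a - ⟪a, n⟫ • n⟫ := by
  have hpos : 0 < 1 + V ^ 2 := by positivity
  have hc : (Real.sqrt (1 + V ^ 2))⁻¹ ^ 2 * (1 + V ^ 2) = 1 := by
    rw [inv_pow, Real.sq_sqrt hpos.le, inv_mul_cancel₀ hpos.ne']
  have hinner : ⟪mk4 a s, mk4 n (-V)⟫ = ⟪a, n⟫ - s * V := by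
    simp [mk4, WithLp.prod_inner_apply]
    ring
  have hG₄ : comp2 G = s + (Real.sqrt (1 + V ^ 2))⁻¹ ^ 2 * (⟪a, n⟫ - s * V) * V := by
    rw [hG, hnS, inner_smul_right, hinner]
    simp [comp2, mk4]
    ring
  rw [hG₄, inner_sub_right, inner_smul_right, ← hV]
  linear_combination -(⟪a, n⟫ - s * V) * V * hc
end
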